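/- Let k be an infinite field and let d ≥ 5. For general forms f₁, f₂, f₃ of degree d in R = k[x,y], setting I = (f₁, f₂, f₃) with J ⊆ I a minimal reduction generated by two general k-linear combinations of f₁, f₂, f₃, the reduction number of I with respect to J equals d−1; that is, I^d = J·I^{d−1} and I^{d−1} ≠ J·I^{d−2}. -/

import Mathlib

open MvPolynomial

noncomputable section

/-- The binary form of degree `d` in `k[x,y]` with coefficient vector `c`
(`x := X 0`, `y := X 1`). -/
def formOf {k : Type*} [Field k] (d : ℕ) (c : Fin (d + 1) → k) :
    MvPolynomial (Fin 2) k :=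
  ∑ l : Fin (d + 1), C (c l) * X 0 ^ (l : ℕ) * X 1 ^ (d - (l : ℕ))

/-- `J` is a reduction of `I` : `J ⊆ I` and `I^{n+1} = J·I^n` for some `n`. -/
def IsReduction {A : Type*} [CommRing A] (I J : Ideal A) : Prop :=
  J ≤ I ∧ ∃ n : ℕ, I ^ (n + 1) = J * I ^ n

/-- `J` is a minimal reduction of `I` : a reduction minimal w.r.t. inclusion. -/
def IsMinimalReduction {A : Type*} [CommRing A] (I J : Ideal A) : Prop :=
  IsReduction I J ∧ ∀ J' : Ideal A, IsReduction I J' → J' ≤ J → J' = J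

section IdealPowers

variable {A : Type*} [CommRing A]

lemma sup_pow_succ_le (J K : Ideal A) (n : ℕ) :
    (J ⊔ K) ^ (n + 1) ≤ J * (J ⊔ K) ^ n ⊔ K ^ (n + 1) := by
  induction n with
  | zero => simp
  | succ n ih =>
    rw [pow_succ' (J ⊔ K) (n + 1), Ideal.sup_mul]
    refine sup_le le_sup_left ((Ideal.mul_mono_right ih).trans ?_)
    rw [Ideal.mul_sup, ← pow_succ']
    refine sup_le_sup_right ?_ _
    rw [mul_left_comm, pow_succ' (J ⊔ K) n]
    exact Ideal.mul_mono_right (Ideal.mul_mono_left le_sup_right)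

/-- The determinant trick: if multiplication by `f` maps a nonzero ideal generated by `d` elements
into `J` times itself, then `f ^ d ∈ J * (J ⊔ (f)) ^ (d - 1)`. -/
lemma pow_mem_mul_of_mul_mem [IsDomain A] {d : ℕ} (J : Ideal A) (f : A) (e : Fin d → A)
    (he : e ≠ 0) (h : ∀ i, f * e i ∈ J * Ideal.span (Set.range e)) :
    f ^ d ∈ J * (J ⊔ Ideal.span {f}) ^ (d - 1) := by
  have h' : ∀ i, ∃ a : Fin d → A, (∀ j, a j ∈ J) ∧ ∑ j, a j * e j = f * e i := by
    intro i
    obtain ⟨a, ha, hs⟩ := (Submodule.mem_ideal_smul_span_iff_exists_sum J e _).1 (h i)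
    refine ⟨a, ha, ?_⟩
    rw [← hs, Finsupp.sum_fintype _ _ (by simp)]
    rfl
  choose N hN hsum using h'
  have hdet : ((Matrix.of N).charpoly).eval f = 0 := by
    rw [Matrix.eval_charpoly, ← Matrix.exists_mulVec_eq_zero_iff]
    refine ⟨e, he, ?_⟩
    ext i
    rw [Matrix.sub_mulVec]
    simp [Matrix.mulVec, dotProduct, hsum, Matrix.scalar_apply]
  have hdeg : (Matrix.of N).charpoly.natDegree = d := by simp
  rw [Polynomial.eval_eq_sum_range, Finset.sum_range_succ, hdeg,
    show (Matrix.of N).charpoly.coeff d = 1 by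
      simpa [hdeg] using (Matrix.charpoly_monic (Matrix.of N)).coeff_natDegree,
    one_mul, add_comm, add_eq_zero_iff_eq_neg] at hdet
  rw [hdet]
  refine neg_mem (sum_mem fun k hk => ?_)
  have hk' : k < d := Finset.mem_range.1 hk
  have h1 : (Matrix.of N).charpoly.coeff k ∈ J ^ (d - k) := by
    simpa using Matrix.coeff_charpoly_mem_ideal_pow (M := Matrix.of N) (I := J) hN k
  have h2 := Ideal.mul_mem_mul h1
    (Ideal.pow_mem_pow (Ideal.mem_span_singleton_self f) k)
  refine SetLike.le_def.1 ?_ h2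
  obtain ⟨m, rfl⟩ : ∃ m, d = k + m + 1 := ⟨d - k - 1, by omega⟩
  rw [show k + m + 1 - k = m + 1 by omega, show k + m + 1 - 1 = m + k by omega, pow_succ',
    pow_add, mul_assoc]
  exact Ideal.mul_mono_right (Ideal.mul_mono (Ideal.pow_right_mono le_sup_left _)
    (Ideal.pow_right_mono le_sup_right _))

end IdealPowers

section Homogeneous

variable {k : Type*} [Field k] {σ : Type*}

lemma MvPolynomial.IsHomogeneous.mem_pow_idealOfVars {p : MvPolynomial σ k} {n : ℕ}
    (hp : p.IsHomogeneous n) : p ∈ idealOfVars σ k ^ n := by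
  rw [mem_pow_idealOfVars_iff']
  exact fun x hx => hp.coeff_eq_zero hx.ne

lemma homogeneousComponent_eq_zero_of_mem_pow {p : MvPolynomial σ k} {n N : ℕ}
    (hp : p ∈ idealOfVars σ k ^ n) (h : N < n) : homogeneousComponent N p = 0 := by
  ext x
  rw [coeff_homogeneousComponent, coeff_zero]
  split_ifs with hx
  · exact (mem_pow_idealOfVars_iff' n p).1 hp x (hx ▸ h)
  · rfl

lemma sub_C_coeff_zero_mem_idealOfVars (p : MvPolynomial σ k) :
    p - C (coeff 0 p) ∈ idealOfVars σ k := by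
  rw [← pow_one (idealOfVars σ k), mem_pow_idealOfVars_iff']
  intro x hx
  have : x = 0 := by simpa [Finsupp.degree_eq_zero_iff] using hx
  simp [this]

lemma homogeneousComponent_mul_of_isHomogeneous {s : MvPolynomial σ k} {N : ℕ}
    (hs : s.IsHomogeneous N) (r : MvPolynomial σ k) :
    homogeneousComponent N (r * s) = C (coeff 0 r) * s := by
  have h1 : r * s = (r - C (coeff 0 r)) * s + C (coeff 0 r) * s := by ring
  have h2 : (r - C (coeff 0 r)) * s ∈ idealOfVars σ k ^ (N + 1) := by
    rw [pow_succ']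
    exact Ideal.mul_mem_mul (sub_C_coeff_zero_mem_idealOfVars r) hs.mem_pow_idealOfVars
  rw [h1, map_add, homogeneousComponent_eq_zero_of_mem_pow h2 (Nat.lt_succ_self N), zero_add,
    homogeneousComponent_eq_self (hs.C_mul _)]

/-- A form of degree `N` in an ideal generated by forms of degree `N` is a linear combination
of the generators. -/
lemma mem_span_of_isHomogeneous_of_mem_ideal_span {S : Set (MvPolynomial σ k)} {N : ℕ}
    (hS : ∀ s ∈ S, s.IsHomogeneous N) {p : MvPolynomial σ k} (hp : p.IsHomogeneous N)
    (hmem : p ∈ Ideal.span S) : p ∈ Submodule.span k S := by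
  rw [← homogeneousComponent_eq_self hp]
  clear hp
  induction hmem using Submodule.span_induction with
  | mem x hx =>
    rw [homogeneousComponent_eq_self (hS x hx)]
    exact Submodule.subset_span hx
  | zero => simp
  | add x y _ _ hx hy => rw [map_add]; exact add_mem hx hy
  | smul a x hx ih =>
    clear ih
    rw [smul_eq_mul]
    induction hx using Submodule.span_induction generalizing a with
    | mem x hx =>
      rw [homogeneousComponent_mul_of_isHomogeneous (hS x hx), ← smul_eq_C_mul]
      exact Submodule.smul_mem _ _ (Submodule.subset_span hx)
    | zero => simp
    | add x y _ _ hx hy => rw [mul_add, map_add]; exact add_mem (hx a) (hy a)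
    | smul b x _ hx => rw [smul_eq_mul, ← mul_assoc]; exact hx _

/-- A form of degree `N` which is a multiple of a form `h` up to terms of degree `> N` is
a multiple of `h`. -/
lemma mem_span_singleton_of_mem_sup {h p : MvPolynomial σ k} {d N : ℕ} (hh : h.IsHomogeneous d)
    (hp : p.IsHomogeneous N) (hmem : p ∈ Ideal.span {h} ⊔ idealOfVars σ k ^ (N + 1)) :
    h ∣ p := by
  obtain ⟨a, ha, q, hq, rfl⟩ := Submodule.mem_sup.1 hmem
  obtain ⟨r, rfl⟩ := Ideal.mem_span_singleton.1 ha
  rw [← homogeneousComponent_eq_self hp, map_add,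
    homogeneousComponent_eq_zero_of_mem_pow hq (Nat.lt_succ_self N), add_zero]
  let _ := gradedAlgebra (σ := σ) (R := k)
  have hI : (Ideal.span {h}).IsHomogeneous (homogeneousSubmodule σ k) :=
    Ideal.homogeneous_span _ _ fun x hx => ⟨d, by rw [Set.mem_singleton_iff.1 hx]; exact hh⟩
  exact Ideal.mem_span_singleton.1 (homogeneousComponent_mem_of_mem hI ha N)

end Homogeneous

section MinimalReduction

variable {k : Type*} [Field k]

lemma not_isUnit_of_mem_idealOfVars {σ : Type*} {h : MvPolynomial σ k}
    (hm : h ∈ idealOfVars σ k) : ¬ IsUnit h := by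
  intro hu
  have h0 : constantCoeff h = 0 := by
    rw [← pow_one (idealOfVars σ k), mem_pow_idealOfVars_iff'] at hm
    exact hm 0 (by simp)
  exact (hu.map constantCoeff).ne_zero h0

lemma isUnit_of_dvd_X_pow {h : MvPolynomial (Fin 2) k} {M N : ℕ} (h0 : h ∣ X 0 ^ M)
    (h1 : h ∣ X 1 ^ N) : IsUnit h := by
  obtain ⟨i, -, hi⟩ := (dvd_prime_pow (X_prime (R := k) (i := (0 : Fin 2))) M).1 h0
  rcases Nat.eq_zero_or_pos i with rfl | hi0
  · rw [pow_zero] at hi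
    exact associated_one_iff_isUnit.1 hi
  · have h2 : (X 0 : MvPolynomial (Fin 2) k) ∣ X 1 :=
      X_prime.dvd_of_dvd_pow (((dvd_pow_self _ hi0.ne').trans hi.symm.dvd).trans h1)
    simp [X_dvd_X] at h2

lemma not_pow_le_span_singleton_sup {d n : ℕ} {g₁ g₂ h : MvPolynomial (Fin 2) k}
    (h₁ : g₁.IsHomogeneous d) (h₂ : g₂.IsHomogeneous d) (hh : h.IsHomogeneous d) (hd : d ≠ 0)
    (hS : idealOfVars (Fin 2) k ^ (2 * d - 1) ≤ Ideal.span {g₁, g₂}) :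
    ¬ Ideal.span {g₁, g₂} ^ (n + 1) ≤
      Ideal.span {h} ⊔ idealOfVars (Fin 2) k ^ (d * (n + 1) + 1) := by
  intro hle
  have hrad : Ideal.span {g₁, g₂} ≤ (Ideal.span {h}).radical := by
    rw [Ideal.span_le]
    rintro g (rfl | rfl)
    · exact ⟨n + 1, Ideal.mem_span_singleton.2 (mem_span_singleton_of_mem_sup hh (h₁.pow (n + 1))
        (hle (Ideal.pow_mem_pow (Ideal.subset_span (by simp)) _)))⟩
    · exact ⟨n + 1, Ideal.mem_span_singleton.2 (mem_span_singleton_of_mem_sup hh (h₂.pow (n + 1))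
        (hle (Ideal.pow_mem_pow (Ideal.subset_span (by simp)) _)))⟩
  have hX : ∀ i, ∃ M, h ∣ X i ^ M := by
    intro i
    have h1 := hrad (hS (Ideal.pow_mem_pow
      (Ideal.subset_span (Set.mem_range_self i) : (X i : MvPolynomial (Fin 2) k) ∈ _) _))
    obtain ⟨M, hM⟩ := Ideal.radical_isRadical _ ⟨_, h1⟩
    exact ⟨M, Ideal.mem_span_singleton.1 hM⟩
  obtain ⟨M, hM⟩ := hX 0
  obtain ⟨N, hN⟩ := hX 1
  exact not_isUnit_of_mem_idealOfVars (Ideal.pow_le_self hd hh.mem_pow_idealOfVars)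
    (isUnit_of_dvd_X_pow hM hN)

lemma exists_le_span_singleton_sup {σ : Type*} {d : ℕ} {g₁ g₂ : MvPolynomial σ k}
    (h₁ : g₁.IsHomogeneous d) (h₂ : g₂.IsHomogeneous d) {J' : Ideal (MvPolynomial σ k)}
    (hJ' : J' ≤ Ideal.span {g₁, g₂})
    (hne : ¬ Ideal.span {g₁, g₂} ≤ J' ⊔ idealOfVars σ k * Ideal.span {g₁, g₂}) :
    ∃ h : MvPolynomial σ k, h.IsHomogeneous d ∧
      J' ≤ Ideal.span {h} ⊔ idealOfVars σ k * Ideal.span {g₁, g₂} := by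
  set L := idealOfVars σ k * Ideal.span {g₁, g₂} with hL
  have key : ∀ p ∈ J', ∃ a b : k, p - (C a * g₁ + C b * g₂) ∈ L := by
    intro p hp
    obtain ⟨r, s, rfl⟩ := Ideal.mem_span_pair.1 (hJ' hp)
    refine ⟨coeff 0 r, coeff 0 s, ?_⟩
    rw [show r * g₁ + s * g₂ - (C (coeff 0 r) * g₁ + C (coeff 0 s) * g₂) =
      (r - C (coeff 0 r)) * g₁ + (s - C (coeff 0 s)) * g₂ by ring]
    exact add_mem
      (Ideal.mul_mem_mul (sub_C_coeff_zero_mem_idealOfVars r) (Ideal.subset_span (by simp)))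
      (Ideal.mul_mem_mul (sub_C_coeff_zero_mem_idealOfVars s) (Ideal.subset_span (by simp)))
  have hcomb : ∀ a b : k, (C a * g₁ + C b * g₂).IsHomogeneous d :=
    fun a b => (h₁.C_mul a).add (h₂.C_mul b)
  have hmem : ∀ p ∈ J', ∀ a b : k, p - (C a * g₁ + C b * g₂) ∈ L →
      C a * g₁ + C b * g₂ ∈ J' ⊔ L := by
    intro p hp a b hab
    have := sub_mem ((le_sup_left : J' ≤ J' ⊔ L) hp) ((le_sup_right : L ≤ J' ⊔ L) hab)
    rwa [sub_sub_cancel] at this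
  have hdet : ∀ a b a' b' : k, C a * g₁ + C b * g₂ ∈ J' ⊔ L → C a' * g₁ + C b' * g₂ ∈ J' ⊔ L →
      a * b' = b * a' := by
    intro a b a' b' hab hab'
    by_contra hD
    have hD' : a * b' - b * a' ≠ 0 := sub_ne_zero.2 hD
    have hCD : C (a * b' - b * a')⁻¹ * (C a * C b' - C b * C a') = (1 : MvPolynomial σ k) := by
      rw [← C_mul, ← C_mul, ← C_sub, ← C_mul, inv_mul_cancel₀ hD', C_1]
    refine hne (Ideal.span_le.2 ?_)
    rintro g (rfl | rfl)
    · have := Ideal.mul_mem_left _ (C (a * b' - b * a')⁻¹)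
        (sub_mem (Ideal.mul_mem_left _ (C b') hab) (Ideal.mul_mem_left _ (C b) hab'))
      rw [show C b' * (C a * g + C b * g₂) - C b * (C a' * g + C b' * g₂) =
        (C a * C b' - C b * C a') * g by ring, ← mul_assoc, hCD, one_mul] at this
      exact this
    · have := Ideal.mul_mem_left _ (C (a * b' - b * a')⁻¹)
        (sub_mem (Ideal.mul_mem_left _ (C a) hab') (Ideal.mul_mem_left _ (C a') hab))
      rw [show C a * (C a' * g₁ + C b' * g) - C a' * (C a * g₁ + C b * g) =
        (C a * C b' - C b * C a') * g by ring, ← mul_assoc, hCD, one_mul] at this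
      exact this
  by_cases hex : ∃ a b : k, (a ≠ 0 ∨ b ≠ 0) ∧ C a * g₁ + C b * g₂ ∈ J' ⊔ L
  · obtain ⟨a, b, hab0, hab⟩ := hex
    refine ⟨_, hcomb a b, fun p hp => ?_⟩
    obtain ⟨a', b', hp'⟩ := key p hp
    have hD := hdet a b a' b' hab (hmem p hp a' b' hp')
    obtain ⟨t, rfl, rfl⟩ : ∃ t : k, a' = t * a ∧ b' = t * b := by
      rcases hab0 with h0 | h0
      · exact ⟨a' / a, by field_simp, by field_simp; linear_combination hD⟩
      · exact ⟨b' / b, by field_simp; linear_combination -hD, by field_simp⟩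
    have ht : C (t * a) * g₁ + C (t * b) * g₂ ∈ Ideal.span {C a * g₁ + C b * g₂} :=
      Ideal.mem_span_singleton.2 ⟨C t, by rw [C_mul, C_mul]; ring⟩
    have := Submodule.add_mem_sup ht hp'
    rwa [add_sub_cancel] at this
  · push Not at hex
    refine ⟨0, isHomogeneous_zero _ _ _, fun p hp => ?_⟩
    obtain ⟨a, b, hab⟩ := key p hp
    have h0 : a = 0 ∧ b = 0 := by
      by_contra hc
      exact hex a b (by tauto) (hmem p hp a b hab)
    rw [h0.1, h0.2] at hab
    exact (le_sup_right : L ≤ _) (by simpa using hab)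

lemma isMinimalReduction_of_isReduction {d : ℕ} (hd : d ≠ 0) {g₁ g₂ : MvPolynomial (Fin 2) k}
    (h₁ : g₁.IsHomogeneous d) (h₂ : g₂.IsHomogeneous d)
    (hS : idealOfVars (Fin 2) k ^ (2 * d - 1) ≤ Ideal.span {g₁, g₂})
    {I : Ideal (MvPolynomial (Fin 2) k)} (hI : I ≤ idealOfVars (Fin 2) k ^ d)
    (hred : IsReduction I (Ideal.span {g₁, g₂})) :
    IsMinimalReduction I (Ideal.span {g₁, g₂}) := by
  refine ⟨hred, fun J' ⟨_, n, hn⟩ hle => le_antisymm hle ?_⟩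
  set J := Ideal.span {g₁, g₂} with hJ
  set m := idealOfVars (Fin 2) k with hm
  have hJI : J ≤ I := hred.1
  have hnak : J ≤ J' ⊔ m * J := by
    by_contra hne
    obtain ⟨h, hh, hJ'h⟩ := exists_le_span_singleton_sup h₁ h₂ hle hne
    refine not_pow_le_span_singleton_sup (n := n) h₁ h₂ hh hd hS ?_
    calc J ^ (n + 1) ≤ I ^ (n + 1) := Ideal.pow_right_mono hJI _
      _ = J' * I ^ n := hn
      _ ≤ (Ideal.span {h} ⊔ m * J) * I ^ n := Ideal.mul_mono_left hJ'h
      _ = Ideal.span {h} * I ^ n ⊔ m * J * I ^ n := Ideal.sup_mul _ _ _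
      _ ≤ Ideal.span {h} ⊔ m ^ (d * (n + 1) + 1) := by
        refine sup_le_sup Ideal.mul_le_left ?_
        rw [mul_assoc, pow_succ' m, pow_mul, pow_succ' (m ^ d)]
        exact Ideal.mul_mono_right
          (Ideal.mul_mono (hJI.trans hI) (Ideal.pow_right_mono hI n))
  have hiter : ∀ N, J ≤ J' ⊔ m ^ N * J := by
    intro N
    induction N with
    | zero => simp
    | succ N ih =>
      refine ih.trans (sup_le le_sup_left ?_)
      refine (Ideal.mul_mono_right hnak).trans ?_
      rw [Ideal.mul_sup, ← mul_assoc, ← pow_succ]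
      exact sup_le_sup_right Ideal.mul_le_right _
  refine (hiter ((2 * d - 1) * (n + 1))).trans (sup_le le_rfl ?_)
  refine Ideal.mul_le_left.trans ?_
  calc m ^ ((2 * d - 1) * (n + 1)) = (m ^ (2 * d - 1)) ^ (n + 1) := pow_mul _ _ _
    _ ≤ I ^ (n + 1) := Ideal.pow_right_mono (hS.trans hJI) _
    _ = J' * I ^ n := hn
    _ ≤ J' := Ideal.mul_le_left

end MinimalReduction

section MonomialFamily

variable {A : Type*} [CommRing A]

/-- The family of monomials of degree `n` in three elements of a ring. -/
def monomialFamily (g₁ g₂ f : A) (n : ℕ)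
    (p : {p : Fin (n + 1) × Fin (n + 1) // (p.1 : ℕ) + p.2 ≤ n}) : A :=
  g₁ ^ (n - p.1.1 - p.1.2) * g₂ ^ (p.1.2 : ℕ) * f ^ (p.1.1 : ℕ)

open scoped Pointwise in
lemma exists_eq_of_mem_triple_pow {g₁ g₂ f : A} (n : ℕ) {z : A}
    (hz : z ∈ ({g₁, g₂, f} : Set A) ^ n) :
    ∃ a b c, a + b + c = n ∧ z = g₁ ^ a * g₂ ^ c * f ^ b := by
  induction n generalizing z with
  | zero => exact ⟨0, 0, 0, rfl, by simpa using hz⟩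
  | succ n ih =>
    rw [pow_succ, Set.mem_mul] at hz
    obtain ⟨w, hw, t, ht, rfl⟩ := hz
    obtain ⟨a, b, c, rfl, rfl⟩ := ih hw
    rcases ht with rfl | rfl | rfl
    · exact ⟨a + 1, b, c, by ring, by ring⟩
    · exact ⟨a, b, c + 1, by ring, by ring⟩
    · exact ⟨a, b + 1, c, by ring, by ring⟩

open scoped Pointwise in
/-- If the monomials of degree `n + 1` in three forms of the same degree are linearly independent,
then the `n + 1`st power of the last form is not in the span of the others. -/
lemma pow_notMem_of_linearIndependent {k σ : Type*} [Field k] {g₁ g₂ f : MvPolynomial σ k}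
    {d : ℕ} (h₁ : g₁.IsHomogeneous d) (h₂ : g₂.IsHomogeneous d) (hf : f.IsHomogeneous d) (n : ℕ)
    (hli : LinearIndependent k (monomialFamily g₁ g₂ f (n + 1))) :
    f ^ (n + 1) ∉ Ideal.span {g₁, g₂} * Ideal.span {g₁, g₂, f} ^ n := by
  intro hmem
  rw [Ideal.span, Ideal.span, Submodule.span_pow, ← Ideal.span, ← Ideal.span,
    Ideal.span_mul_span'] at hmem
  have hprod : ∀ z ∈ ({g₁, g₂} : Set (MvPolynomial σ k)) * ({g₁, g₂, f} : Set _) ^ n,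
      ∃ a b c, a + b + c = n + 1 ∧ b ≤ n ∧ z = g₁ ^ a * g₂ ^ c * f ^ b := by
    intro z hz
    obtain ⟨t, ht, w, hw, rfl⟩ := Set.mem_mul.1 hz
    obtain ⟨a, b, c, rfl, rfl⟩ := exists_eq_of_mem_triple_pow n hw
    rcases ht with rfl | rfl
    · exact ⟨a + 1, b, c, by ring, by omega, by ring⟩
    · exact ⟨a, b, c + 1, by ring, by omega, by ring⟩
  have hspan := mem_span_of_isHomogeneous_of_mem_ideal_span (N := d * (n + 1)) ?_
    (hf.pow (n + 1)) hmem
  · let top : {p : Fin (n + 1 + 1) × Fin (n + 1 + 1) // (p.1 : ℕ) + p.2 ≤ n + 1} :=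
      ⟨(Fin.last _, 0), by simp⟩
    refine hli.notMem_span_image (s := {top}ᶜ) (x := top) (by simp) ?_
    have htop : monomialFamily g₁ g₂ f (n + 1) top = f ^ (n + 1) := by
      simp [monomialFamily, top]
    rw [htop]
    refine Submodule.span_mono ?_ hspan
    intro z hz
    obtain ⟨a, b, c, habc, hb, rfl⟩ := hprod z hz
    refine ⟨⟨(⟨b, by omega⟩, ⟨c, by omega⟩), by simp; omega⟩, ?_, ?_⟩
    · simp only [Set.mem_compl_iff, Set.mem_singleton_iff, top, Subtype.mk.injEq, Prod.mk.injEq,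
        Fin.ext_iff, Fin.val_last]
      omega
    · simp only [monomialFamily]
      rw [show n + 1 - b - c = a by omega]
  · intro z hz
    obtain ⟨a, b, c, habc, -, rfl⟩ := hprod z hz
    rw [← habc, show d * (a + b + c) = d * a + d * c + d * b by ring]
    exact ((h₁.pow a).mul (h₂.pow c)).mul (hf.pow b)

end MonomialFamily

section CoefficientMatrix

variable {k τ ι : Type*} [Field k] [Fintype ι] [DecidableEq ι]

/-- The matrix of the coefficients of a family of polynomials at given monomials. -/
def coeffMatrix {R : Type*} [CommRing R] (v : ι → MvPolynomial τ R) (e : ι → τ →₀ ℕ) :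
    Matrix ι ι R :=
  Matrix.of fun i j => coeff (e j) (v i)

lemma linearIndependent_of_det_coeffMatrix_ne_zero {v : ι → MvPolynomial τ k} {e : ι → τ →₀ ℕ}
    (h : (coeffMatrix v e).det ≠ 0) : LinearIndependent k v :=
  LinearIndependent.of_comp (LinearMap.pi fun j => lcoeff k (e j))
    (Matrix.linearIndependent_rows_of_det_ne_zero h)

lemma monomial_mem_span_of_det_coeffMatrix_ne_zero {v : ι → MvPolynomial τ k} {e : ι → τ →₀ ℕ}
    (h : (coeffMatrix v e).det ≠ 0) (he : Function.Injective e) {N : ℕ}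
    (hv : ∀ i, (v i).IsHomogeneous N) (hsurj : ∀ x : τ →₀ ℕ, x.degree = N → ∃ j, e j = x)
    {x : τ →₀ ℕ} (hx : x.degree = N) : monomial x 1 ∈ Submodule.span k (Set.range v) := by
  classical
  obtain ⟨j, rfl⟩ := hsurj x hx
  have hsum : monomial (e j) 1 = ∑ i, (coeffMatrix v e)⁻¹ j i • v i := by
    ext y
    by_cases hy : y.degree = N
    · obtain ⟨j', rfl⟩ := hsurj y hy
      have := congrFun₂ (Matrix.nonsing_inv_mul (coeffMatrix v e) (isUnit_iff_ne_zero.2 h)) j j'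
      rw [Matrix.mul_apply, Matrix.one_apply] at this
      simpa [coeff_monomial, coeff_sum, he.eq_iff, coeffMatrix] using this.symm
    · rw [(isHomogeneous_monomial 1 hx).coeff_eq_zero hy, coeff_sum]
      simp [(hv _).coeff_eq_zero hy]
  rw [hsum]
  exact sum_mem fun i _ => Submodule.smul_mem _ _ (Submodule.subset_span (Set.mem_range_self i))

lemma exists_eval_ne_zero_of_coeff_eq_one {σ : Type*}
    (v : ι → MvPolynomial τ (MvPolynomial σ k)) (e : ι → τ →₀ ℕ) (he : Function.Injective e)
    (s₀ : σ → k) (h₀ : ∀ i, map (eval s₀) (v i) = monomial (e i) 1) :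
    ∃ P : MvPolynomial σ k, eval s₀ P ≠ 0 ∧
      ∀ s, eval s P ≠ 0 → (coeffMatrix (fun i => map (eval s) (v i)) e).det ≠ 0 := by
  classical
  have key : ∀ s, eval s (coeffMatrix v e).det =
      (coeffMatrix (fun i => map (eval s) (v i)) e).det := by
    intro s
    rw [RingHom.map_det]
    congr 1
  refine ⟨(coeffMatrix v e).det, ?_, fun s hs => key s ▸ hs⟩
  have h1 : coeffMatrix (fun i => map (eval s₀) (v i)) e = 1 := by
    ext i j
    simp [coeffMatrix, h₀, coeff_monomial, he.eq_iff, Matrix.one_apply]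
  rw [key, h1, Matrix.det_one]
  exact one_ne_zero

end CoefficientMatrix

section GenericForms

variable {k : Type*} [Field k]

/-- The exponent vector of the monomial `x ^ a * y ^ b`. -/
def binaryExponent (a b : ℕ) : Fin 2 →₀ ℕ :=
  Finsupp.single 0 a + Finsupp.single 1 b

@[simp] lemma binaryExponent_zero_apply (a b : ℕ) : binaryExponent a b 0 = a := by
  simp [binaryExponent]

@[simp] lemma binaryExponent_one_apply (a b : ℕ) : binaryExponent a b 1 = b := by
  simp [binaryExponent]

lemma binaryExponent_inj {a b a' b' : ℕ} :
    binaryExponent a b = binaryExponent a' b' ↔ a = a' ∧ b = b' := by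
  simp [Finsupp.ext_iff, Fin.forall_fin_two]

lemma degree_eq_add (x : Fin 2 →₀ ℕ) : x.degree = x 0 + x 1 := by
  simp [Finsupp.degree_eq_sum]

lemma degree_binaryExponent (a b : ℕ) : (binaryExponent a b).degree = a + b := by
  simp [degree_eq_add]

lemma eq_binaryExponent (x : Fin 2 →₀ ℕ) : x = binaryExponent (x 0) (x 1) := by
  simp [Finsupp.ext_iff, Fin.forall_fin_two]

lemma monomial_binaryExponent {R : Type*} [CommSemiring R] (a b : ℕ) :
    monomial (binaryExponent a b) (1 : R) = X 0 ^ a * X 1 ^ b := by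
  simp [binaryExponent, X_pow_eq_monomial, monomial_mul]

lemma isHomogeneous_formOf (d : ℕ) (c : Fin (d + 1) → k) : (formOf d c).IsHomogeneous d := by
  refine IsHomogeneous.sum _ _ _ fun l _ => ?_
  have h := ((isHomogeneous_C (Fin 2) (c l)).mul (isHomogeneous_X_pow 0 (l : ℕ))).mul
    (isHomogeneous_X_pow 1 (d - (l : ℕ)))
  rwa [zero_add, Nat.add_sub_cancel' (by omega)] at h

lemma formOf_ite (d : ℕ) (i : Fin (d + 1)) :
    formOf d (fun l => if l = i then (1 : k) else 0) = X 0 ^ (i : ℕ) * X 1 ^ (d - (i : ℕ)) := by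
  simp [formOf]

variable (k) in
/-- The form of degree `d` whose coefficients are the indeterminates `X (Sum.inl (i, l))`. -/
def genericForm (d : ℕ) (i : Fin 3) :
    MvPolynomial (Fin 2) (MvPolynomial ((Fin 3 × Fin (d + 1)) ⊕ (Fin 2 × Fin 3)) k) :=
  ∑ l : Fin (d + 1), C (X (Sum.inl (i, l))) * X 0 ^ (l : ℕ) * X 1 ^ (d - (l : ℕ))

variable (k) in
/-- The generic linear combinations of the three generic forms. -/
def genericCombination (d : ℕ) (i : Fin 2) :
    MvPolynomial (Fin 2) (MvPolynomial ((Fin 3 × Fin (d + 1)) ⊕ (Fin 2 × Fin 3)) k) :=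
  ∑ j : Fin 3, C (X (Sum.inr (i, j))) * genericForm k d j

lemma map_genericForm (d : ℕ) (i : Fin 3) (s : (Fin 3 × Fin (d + 1)) ⊕ (Fin 2 × Fin 3) → k) :
    map (eval s) (genericForm k d i) = formOf d (fun l => s (Sum.inl (i, l))) := by
  simp [genericForm, formOf]

lemma map_genericCombination (d : ℕ) (i : Fin 2)
    (s : (Fin 3 × Fin (d + 1)) ⊕ (Fin 2 × Fin 3) → k) :
    map (eval s) (genericCombination k d i) =
      ∑ j : Fin 3, C (s (Sum.inr (i, j))) * formOf d (fun l => s (Sum.inl (j, l))) := by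
  simp [genericCombination, map_genericForm]

variable (k) in
/-- The coefficients for which the three forms are `x ^ d`, `y ^ d`, `x ^ (d - 1) * y` and the
linear combinations are the first two of them. -/
def basePoint (d : ℕ) : (Fin 3 × Fin (d + 1)) ⊕ (Fin 2 × Fin 3) → k :=
  Sum.elim (fun p => if p.2 = ![Fin.last d, 0, ⟨d - 1, by omega⟩] p.1 then 1 else 0)
    (fun p => if p.2 = p.1.castSucc then 1 else 0)

lemma map_genericForm_two_basePoint {d : ℕ} (hd : d ≠ 0) :
    map (eval (basePoint k d)) (genericForm k d 2) =
      monomial (binaryExponent (d - 1) 1) 1 := by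
  rw [map_genericForm, monomial_binaryExponent]
  refine (formOf_ite d ⟨d - 1, by omega⟩).trans ?_
  rw [show d - (d - 1) = 1 by omega]

lemma map_genericCombination_zero_basePoint (d : ℕ) :
    map (eval (basePoint k d)) (genericCombination k d 0) = monomial (binaryExponent d 0) 1 := by
  simp [map_genericCombination, basePoint, formOf_ite, monomial_binaryExponent]

lemma map_genericCombination_one_basePoint (d : ℕ) :
    map (eval (basePoint k d)) (genericCombination k d 1) = monomial (binaryExponent 0 d) 1 := by
  simp [map_genericCombination, basePoint, formOf_ite, monomial_binaryExponent]

/-- The Sylvester family of two polynomials. -/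
def sylvesterFamily {R : Type*} [CommRing R] (d : ℕ) (g₁ g₂ : MvPolynomial (Fin 2) R) :
    Fin d ⊕ Fin d → MvPolynomial (Fin 2) R :=
  Sum.elim (fun j => g₁ * monomial (binaryExponent j (d - 1 - j)) 1)
    (fun j => g₂ * monomial (binaryExponent j (d - 1 - j)) 1)

/-- The exponents of the monomials of degree `2 * d - 1`. -/
def sylvesterExponent (d : ℕ) : Fin d ⊕ Fin d → Fin 2 →₀ ℕ :=
  Sum.elim (fun j => binaryExponent (d + j) (d - 1 - j))
    (fun j => binaryExponent j (d + (d - 1 - j)))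

lemma sylvesterExponent_injective (d : ℕ) : Function.Injective (sylvesterExponent d) := by
  rintro (i | i) (j | j) h <;>
  simp only [sylvesterExponent, Sum.elim_inl, Sum.elim_inr, binaryExponent_inj] at h
  · rw [Fin.ext (show (i : ℕ) = j by omega)]
  · omega
  · omega
  · rw [Fin.ext (show (i : ℕ) = j by omega)]

lemma exists_sylvesterExponent_eq (d : ℕ) (x : Fin 2 →₀ ℕ) (hd : d ≠ 0)
    (hx : x.degree = 2 * d - 1) : ∃ j, sylvesterExponent d j = x := by
  rw [degree_eq_add] at hx
  rw [eq_binaryExponent x]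
  rcases lt_or_ge (x 0) d with h | h
  · refine ⟨Sum.inr ⟨x 0, h⟩, ?_⟩
    simp only [sylvesterExponent, Sum.elim_inr, binaryExponent_inj, true_and]
    omega
  · refine ⟨Sum.inl ⟨x 0 - d, by omega⟩, ?_⟩
    simp only [sylvesterExponent, Sum.elim_inl, binaryExponent_inj]
    omega

lemma isHomogeneous_monomial_binaryExponent {d : ℕ} (j : Fin d) :
    (monomial (binaryExponent j (d - 1 - j)) (1 : k)).IsHomogeneous (d - 1) :=
  isHomogeneous_monomial _ (by rw [degree_binaryExponent]; omega)

lemma span_range_monomial_eq_pow_idealOfVars {d : ℕ} (hd : d ≠ 0) :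
    Ideal.span (Set.range fun j : Fin d => monomial (binaryExponent j (d - 1 - j)) (1 : k)) =
      idealOfVars (Fin 2) k ^ (d - 1) := by
  rw [pow_idealOfVars_eq_span]
  congr 1
  ext p
  constructor
  · rintro ⟨j, rfl⟩
    refine ⟨_, ?_, rfl⟩
    simp only [Set.mem_preimage, degree_binaryExponent, Set.mem_singleton_iff]
    omega
  · rintro ⟨x, hx, rfl⟩
    simp only [Set.mem_preimage, degree_eq_add, Set.mem_singleton_iff] at hx
    refine ⟨⟨x 0, by omega⟩, ?_⟩
    simp only
    rw [show d - 1 - x 0 = x 1 by omega, ← eq_binaryExponent]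

lemma pow_idealOfVars_le_of_det_ne_zero {d : ℕ} (hd : d ≠ 0) {g₁ g₂ : MvPolynomial (Fin 2) k}
    (h₁ : g₁.IsHomogeneous d) (h₂ : g₂.IsHomogeneous d)
    (h : (coeffMatrix (sylvesterFamily d g₁ g₂) (sylvesterExponent d)).det ≠ 0) :
    idealOfVars (Fin 2) k ^ (2 * d - 1) ≤
      Ideal.span {g₁, g₂} * idealOfVars (Fin 2) k ^ (d - 1) := by
  have hhom : ∀ i, (sylvesterFamily d g₁ g₂ i).IsHomogeneous (2 * d - 1) := by
    rw [show 2 * d - 1 = d + (d - 1) by omega]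
    rintro (j | j)
    · exact h₁.mul (isHomogeneous_monomial_binaryExponent j)
    · exact h₂.mul (isHomogeneous_monomial_binaryExponent j)
  have hmem : Set.range (sylvesterFamily d g₁ g₂) ⊆
      (Ideal.span {g₁, g₂} * idealOfVars (Fin 2) k ^ (d - 1) : Ideal _) := by
    rintro _ ⟨j | j, rfl⟩
    · exact Ideal.mul_mem_mul (Ideal.subset_span (by simp))
        (isHomogeneous_monomial_binaryExponent j).mem_pow_idealOfVars
    · exact Ideal.mul_mem_mul (Ideal.subset_span (by simp))
        (isHomogeneous_monomial_binaryExponent j).mem_pow_idealOfVars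
  rw [pow_idealOfVars_eq_span (2 * d - 1), Ideal.span_le]
  rintro _ ⟨x, hx, rfl⟩
  have h1 := monomial_mem_span_of_det_coeffMatrix_ne_zero h (sylvesterExponent_injective d) hhom
    (fun x hx => exists_sylvesterExponent_eq d x hd hx) hx
  exact (Submodule.span_le (p := (Ideal.span {g₁, g₂} *
    idealOfVars (Fin 2) k ^ (d - 1)).restrictScalars k)).2 hmem h1

variable (k) in
lemma exists_sylvester_polynomial (d : ℕ) :
    ∃ P : MvPolynomial ((Fin 3 × Fin (d + 1)) ⊕ (Fin 2 × Fin 3)) k, eval (basePoint k d) P ≠ 0 ∧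
      ∀ s, eval s P ≠ 0 →
        (coeffMatrix (sylvesterFamily d (map (eval s) (genericCombination k d 0))
          (map (eval s) (genericCombination k d 1))) (sylvesterExponent d)).det ≠ 0 := by
  have hmap : ∀ s : (Fin 3 × Fin (d + 1)) ⊕ (Fin 2 × Fin 3) → k,
      (fun i => map (eval s)
        (sylvesterFamily d (genericCombination k d 0) (genericCombination k d 1) i)) =
      sylvesterFamily d (map (eval s) (genericCombination k d 0))
        (map (eval s) (genericCombination k d 1)) := by
    intro s
    ext1 i
    rcases i with j | j <;> simp [sylvesterFamily, map_monomial]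
  obtain ⟨P, hP, hP'⟩ := exists_eval_ne_zero_of_coeff_eq_one
    (sylvesterFamily d (genericCombination k d 0) (genericCombination k d 1))
    (sylvesterExponent d) (sylvesterExponent_injective d) (basePoint k d) (by
      intro i
      rw [congrFun (hmap _) i, map_genericCombination_zero_basePoint,
        map_genericCombination_one_basePoint]
      rcases i with j | j <;>
      simp [sylvesterFamily, sylvesterExponent, monomial_binaryExponent] <;> ring)
  exact ⟨P, hP, fun s hs => hmap s ▸ hP' s hs⟩

variable (k) in
lemma exists_linearIndependent_polynomial {d : ℕ} (hd : d ≠ 0) :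
    ∃ P : MvPolynomial ((Fin 3 × Fin (d + 1)) ⊕ (Fin 2 × Fin 3)) k, eval (basePoint k d) P ≠ 0 ∧
      ∀ s, eval s P ≠ 0 →
        LinearIndependent k (monomialFamily (map (eval s) (genericCombination k d 0))
          (map (eval s) (genericCombination k d 1)) (map (eval s) (genericForm k d 2))
            (d - 1)) := by
  have hmap : ∀ s : (Fin 3 × Fin (d + 1)) ⊕ (Fin 2 × Fin 3) → k,
      (fun i => map (eval s) (monomialFamily (genericCombination k d 0)
        (genericCombination k d 1) (genericForm k d 2) (d - 1) i)) =
      monomialFamily (map (eval s) (genericCombination k d 0))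
        (map (eval s) (genericCombination k d 1)) (map (eval s) (genericForm k d 2))
          (d - 1) := by
    intro s
    ext1 i
    simp [monomialFamily]
  obtain ⟨P, hP, hP'⟩ := exists_eval_ne_zero_of_coeff_eq_one
    (monomialFamily (genericCombination k d 0) (genericCombination k d 1)
      (genericForm k d 2) (d - 1))
    (fun p => binaryExponent (d * (d - 1 - p.1.1 - p.1.2) + (d - 1) * p.1.1)
      (d * p.1.2 + p.1.1)) (by
      rintro ⟨⟨b, c⟩, h⟩ ⟨⟨b', c'⟩, h'⟩ heq
      have h2 := (binaryExponent_inj.1 heq).2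
      simp only at h2
      have hb : (b : ℕ) < d := by omega
      have hb' : (b' : ℕ) < d := by omega
      have hbb : (b : ℕ) = b' := by
        simpa [Nat.mod_eq_of_lt hb, Nat.mod_eq_of_lt hb'] using congrArg (· % d) h2
      have hcc : (c : ℕ) = c' := by
        rw [hbb] at h2
        exact Nat.eq_of_mul_eq_mul_left (Nat.pos_of_ne_zero hd) (Nat.add_right_cancel h2)
      simp [Fin.ext_iff, hbb, hcc])
    (basePoint k d) (by
      intro i
      rw [congrFun (hmap _) i, map_genericCombination_zero_basePoint,
        map_genericCombination_one_basePoint, map_genericForm_two_basePoint hd]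
      simp only [monomialFamily, monomial_binaryExponent]
      ring)
  exact ⟨P, hP, fun s hs => linearIndependent_of_det_coeffMatrix_ne_zero (hmap s ▸ hP' s hs)⟩

end GenericForms

section ReductionNumber

variable {k : Type*} [Field k]

lemma span_triple_eq_of_ne_zero {A : Type*} [CommRing A] [Algebra k A] (f : Fin 3 → A)
    (u : Fin 2 → Fin 3 → k) (hu : u 0 0 * u 1 1 - u 0 1 * u 1 0 ≠ 0) :
    Ideal.span {f 0, f 1, f 2} =
      Ideal.span {∑ j, algebraMap k A (u 0 j) * f j, ∑ j, algebraMap k A (u 1 j) * f j, f 2} := by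
  simp only [Fin.sum_univ_three]
  set a := algebraMap k A
  set K := Ideal.span {a (u 0 0) * f 0 + a (u 0 1) * f 1 + a (u 0 2) * f 2,
    a (u 1 0) * f 0 + a (u 1 1) * f 1 + a (u 1 2) * f 2, f 2} with hK
  have hinv : a (u 0 0 * u 1 1 - u 0 1 * u 1 0)⁻¹ *
      (a (u 0 0) * a (u 1 1) - a (u 0 1) * a (u 1 0)) = 1 := by
    rw [← map_mul, ← map_mul, ← map_sub, ← map_mul, inv_mul_cancel₀ hu, map_one]
  have m0 : a (u 0 0) * f 0 + a (u 0 1) * f 1 + a (u 0 2) * f 2 ∈ K :=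
    Ideal.subset_span (by simp)
  have m1 : a (u 1 0) * f 0 + a (u 1 1) * f 1 + a (u 1 2) * f 2 ∈ K :=
    Ideal.subset_span (by simp)
  have m2 : f 2 ∈ K := Ideal.subset_span (by simp)
  refine le_antisymm (Ideal.span_le.2 ?_) (Ideal.span_le.2 ?_)
  · rintro x (rfl | rfl | rfl)
    · have h := K.mul_mem_left (a (u 0 0 * u 1 1 - u 0 1 * u 1 0)⁻¹)
        (sub_mem (K.mul_mem_left (a (u 1 1)) (sub_mem m0 (K.mul_mem_left (a (u 0 2)) m2)))
          (K.mul_mem_left (a (u 0 1)) (sub_mem m1 (K.mul_mem_left (a (u 1 2)) m2))))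
      refine (congrArg (· ∈ K) ?_).mp h
      linear_combination f 0 * hinv
    · have h := K.mul_mem_left (a (u 0 0 * u 1 1 - u 0 1 * u 1 0)⁻¹)
        (sub_mem (K.mul_mem_left (a (u 0 0)) (sub_mem m1 (K.mul_mem_left (a (u 1 2)) m2)))
          (K.mul_mem_left (a (u 1 0)) (sub_mem m0 (K.mul_mem_left (a (u 0 2)) m2))))
      refine (congrArg (· ∈ K) ?_).mp h
      linear_combination f 1 * hinv
    · exact m2
  · have n : ∀ i, f i ∈ Ideal.span {f 0, f 1, f 2} := by
      intro i
      fin_cases i <;> exact Ideal.subset_span (by simp)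
    have n' : ∀ i, a (u i 0) * f 0 + a (u i 1) * f 1 + a (u i 2) * f 2 ∈
        Ideal.span {f 0, f 1, f 2} := fun i =>
      add_mem (add_mem (Ideal.mul_mem_left _ _ (n 0)) (Ideal.mul_mem_left _ _ (n 1)))
        (Ideal.mul_mem_left _ _ (n 2))
    rintro x (rfl | rfl | rfl)
    · exact n' 0
    · exact n' 1
    · exact n 2

lemma pow_eq_mul_pow_of_pow_idealOfVars_le {d : ℕ} (hd : d ≠ 0)
    {g₁ g₂ f : MvPolynomial (Fin 2) k} (hf : f.IsHomogeneous d)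
    (hS : idealOfVars (Fin 2) k ^ (2 * d - 1) ≤
      Ideal.span {g₁, g₂} * idealOfVars (Fin 2) k ^ (d - 1)) :
    Ideal.span {g₁, g₂, f} ^ d = Ideal.span {g₁, g₂} * Ideal.span {g₁, g₂, f} ^ (d - 1) := by
  have hI : Ideal.span {g₁, g₂, f} = Ideal.span {g₁, g₂} ⊔ Ideal.span {f} := by
    rw [← Ideal.span_union]
    congr 1
    ext
    simp
    tauto
  obtain ⟨n, rfl⟩ := Nat.exists_eq_succ_of_ne_zero hd
  rw [hI]
  apply le_antisymm
  · refine (sup_pow_succ_le _ _ n).trans (sup_le le_rfl ?_)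
    rw [Ideal.span_singleton_pow, Ideal.span_singleton_le_iff_mem]
    refine pow_mem_mul_of_mul_mem _ f
      (fun j : Fin (n + 1) => monomial (binaryExponent j (n + 1 - 1 - j)) (1 : k)) ?_ ?_
    · intro h
      simpa using congrFun h 0
    · intro i
      rw [span_range_monomial_eq_pow_idealOfVars hd]
      refine hS ?_
      rw [show 2 * (n + 1) - 1 = (n + 1) + (n + 1 - 1) by omega, pow_add]
      exact Ideal.mul_mem_mul hf.mem_pow_idealOfVars
        (isHomogeneous_monomial_binaryExponent i).mem_pow_idealOfVars
  · rw [pow_succ']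
    exact Ideal.mul_mono_left le_sup_left

end ReductionNumber

/-- For an infinite field `k` and `d ≥ 5`, for general forms `f₁, f₂, f₃` of degree `d`
in `R = k[x,y]` together with two general `k`-linear combinations `g₁, g₂` of them
(genericity encoded as the nonvanishing locus of a nonzero polynomial), with
`I = (f₁,f₂,f₃)` and the minimal reduction `J = (g₁,g₂)`, the reduction number of `I`
with respect to `J` equals `d−1`: `I^d = J·I^{d−1}` and `I^{d−1} ≠ J·I^{d−2}`. -/
theorem reduction_number_general_binary_forms (k : Type*) [Field k] [Infinite k]
    (d : ℕ) (hd : 5 ≤ d) :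
    ∃ P : MvPolynomial ((Fin 3 × Fin (d + 1)) ⊕ (Fin 2 × Fin 3)) k, P ≠ 0 ∧
      ∀ (c : Fin 3 → Fin (d + 1) → k) (u : Fin 2 → Fin 3 → k),
        eval (Sum.elim (fun p => c p.1 p.2) (fun p => u p.1 p.2)) P ≠ 0 →
          IsMinimalReduction
            (Ideal.span {formOf d (c 0), formOf d (c 1), formOf d (c 2)})
            (Ideal.span {∑ j : Fin 3, C (u 0 j) * formOf d (c j),
                          ∑ j : Fin 3, C (u 1 j) * formOf d (c j)}) ∧
          (Ideal.span {formOf d (c 0), formOf d (c 1), formOf d (c 2)}) ^ d =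
            Ideal.span {∑ j : Fin 3, C (u 0 j) * formOf d (c j),
                         ∑ j : Fin 3, C (u 1 j) * formOf d (c j)} *
              (Ideal.span {formOf d (c 0), formOf d (c 1), formOf d (c 2)}) ^ (d - 1) ∧
          (Ideal.span {formOf d (c 0), formOf d (c 1), formOf d (c 2)}) ^ (d - 1) ≠
            Ideal.span {∑ j : Fin 3, C (u 0 j) * formOf d (c j),
                         ∑ j : Fin 3, C (u 1 j) * formOf d (c j)} *
              (Ideal.span {formOf d (c 0), formOf d (c 1), formOf d (c 2)}) ^ (d - 2) := by
  have hd0 : d ≠ 0 := by omega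
  obtain ⟨P, hP, hP'⟩ := exists_sylvester_polynomial k d
  obtain ⟨Q, hQ, hQ'⟩ := exists_linearIndependent_polynomial k hd0
  let D : MvPolynomial ((Fin 3 × Fin (d + 1)) ⊕ (Fin 2 × Fin 3)) k :=
    X (Sum.inr (0, 0)) * X (Sum.inr (1, 1)) - X (Sum.inr (0, 1)) * X (Sum.inr (1, 0))
  have hD : eval (basePoint k d) D ≠ 0 := by
    simp [D, basePoint]
  refine ⟨P * Q * D, fun h => ?_, fun c u hcu => ?_⟩
  · have := congrArg (eval (basePoint k d)) h
    rw [map_mul, map_mul, map_zero] at this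
    exact mul_ne_zero (mul_ne_zero hP hQ) hD this
  · rw [map_mul, map_mul] at hcu
    have hsyl := hP' _ (left_ne_zero_of_mul (left_ne_zero_of_mul hcu))
    have hli := hQ' _ (right_ne_zero_of_mul (left_ne_zero_of_mul hcu))
    have hu : u 0 0 * u 1 1 - u 0 1 * u 1 0 ≠ 0 := by
      simpa [D] using right_ne_zero_of_mul hcu
    simp only [map_genericCombination, map_genericForm, Sum.elim_inl, Sum.elim_inr] at hsyl hli
    rw [show Ideal.span {formOf d (c 0), formOf d (c 1), formOf d (c 2)} =
      Ideal.span {∑ j : Fin 3, C (u 0 j) * formOf d (c j),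
        ∑ j : Fin 3, C (u 1 j) * formOf d (c j), formOf d (c 2)} from
      span_triple_eq_of_ne_zero (fun j => formOf d (c j)) u hu]
    have hf := isHomogeneous_formOf d (c 2)
    have hg : ∀ i, (∑ j : Fin 3, C (u i j) * formOf d (c j)).IsHomogeneous d := fun i =>
      IsHomogeneous.sum _ _ _ fun j _ => (isHomogeneous_formOf d (c j)).C_mul _
    have h₁ := hg 0
    have h₂ := hg 1
    generalize ∑ j : Fin 3, C (u 0 j) * formOf d (c j) = g₁ at *
    generalize ∑ j : Fin 3, C (u 1 j) * formOf d (c j) = g₂ at *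
    generalize formOf d (c 2) = f at *
    have hS := pow_idealOfVars_le_of_det_ne_zero hd0 h₁ h₂ hsyl
    have hpow := pow_eq_mul_pow_of_pow_idealOfVars_le hd0 hf hS
    refine ⟨isMinimalReduction_of_isReduction hd0 h₁ h₂ (hS.trans Ideal.mul_le_left) ?_
      ⟨Ideal.span_mono (by grind), d - 1, ?_⟩, hpow, fun heq => ?_⟩
    · rw [Ideal.span_le]
      rintro x (rfl | rfl | rfl)
      exacts [h₁.mem_pow_idealOfVars, h₂.mem_pow_idealOfVars, hf.mem_pow_idealOfVars]
    · rwa [Nat.sub_add_cancel (by omega)]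
    · rw [show d - 1 = d - 2 + 1 by omega] at hli heq
      refine pow_notMem_of_linearIndependent h₁ h₂ hf (d - 2) hli (heq ▸ ?_)
      exact Ideal.pow_mem_pow (Ideal.subset_span (by simp)) _
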